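/- arXiv:1509.05015 — 5 statements merged into one kernel-verified Lean document; each statement's English description precedes it below -/
import Mathlib

section
/- Let μ be a measure on (Σ, F⁰) that is σ-finite on F₀⁰, and let (Υ, G) be a measurable space. Let ν : Υ × F⁰ → [0,∞] be such that for every υ ∈ Υ, ν(υ,·) is a finite measure on (Σ, F⁰) that is locally absolutely continuous w.r.t. μ, with local Radon–Nikodym derivatives (M_t(υ,·))_{t≥0}, where for every t ≥ 0 the map M_t : Υ × Σ_t → [0,∞) is measurable w.r.t. the product σ-algebra of G and the trace σ-algebra F_t⁰ ∩ Σ_t. Then ν is a kernel from (Υ, G) to (Σ, F⁰). Moreover, if ξ is a σ-finite measure on (Υ, G) such that for μ-a.e. f ∈ Σ one has ∫_Υ M_t(υ, f) dξ(υ) < ∞ for all t ≥ 0, then the measure ξ·ν defined by (ξ·ν)(F) = ∫_Υ ν(υ, F) dξ(υ) is locally absolutely continuous w.r.t. μ, with local Radon–Nikodym derivatives f ↦ ∫_Υ M_t(υ, f) dξ(υ), t ≥ 0. -/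
open MeasureTheory Set Filter ENNReal Topology

noncomputable section

/-- The space `Σ` of continuous real-valued functions with a (possibly infinite) lifetime
`T ∈ (0,∞]`; a path is normalized to take the value `0` outside of its domain `[0,T)`. -/
structure RPath where
  T : ℝ≥0∞
  pos : 0 < T
  toFun : ℝ → ℝ
  cont : ContinuousOn toFun {t : ℝ | 0 ≤ t ∧ ENNReal.ofReal t < T}
  zero : ∀ t : ℝ, ¬(0 ≤ t ∧ ENNReal.ofReal t < T) → toFun t = 0

namespace RPath

/-- Generating sets of the σ-algebra `F_t⁰`. -/
def cyl (t : ℝ) : Set (Set RPath) :=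
  {A | ∃ s : ℝ, 0 ≤ s ∧ s ≤ t ∧ ∃ U : Set ℝ, MeasurableSet U ∧
      A = {f : RPath | ENNReal.ofReal s < f.T ∧ f.toFun s ∈ U}}

/-- The σ-algebra `F_t⁰`. -/
def F0 (t : ℝ) : MeasurableSpace RPath := .generateFrom (cyl t)

/-- The σ-algebra `F⁰ = σ(⋃_{t ≥ 0} F_t⁰)`. -/
def Finf : MeasurableSpace RPath := ⨆ t : ℝ, F0 t

instance : MeasurableSpace RPath := Finf

lemma F0_le (t : ℝ) : F0 t ≤ Finf := le_iSup F0 t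

/-- The subspace `Σ_t = {f : T_f > t}`. -/
def SigmaT (t : ℝ) : Set RPath := {f | ENNReal.ofReal t < f.T}

/-- The trace σ-algebra `F_t⁰ ∩ Σ_t`, as a collection of subsets of `Σ`. -/
def trace (t : ℝ) : Set (Set RPath) :=
  {E | ∃ A : Set RPath, MeasurableSet[F0 t] A ∧ E = A ∩ SigmaT t}

/-- The killing map `K_r` for `0 < r ≤ ∞` (junk value if `r = 0`). -/
def kill (r : ℝ≥0∞) (f : RPath) : RPath :=
  if h : 0 < r then
    { T := min r f.T
      pos := lt_min h f.pos
      toFun := fun t => if ht : 0 ≤ t ∧ ENNReal.ofReal t < min r f.T then f.toFun t else 0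
      cont := (f.cont.mono fun t ht =>
          ⟨ht.1, lt_of_lt_of_le ht.2 (min_le_right _ _)⟩).congr fun t ht => dif_pos ht
      zero := fun t ht => dif_neg ht }
  else f

/-- `ν` is locally absolutely continuous w.r.t. `μ`: for every `t ≥ 0` the restriction of `ν`
to the trace σ-algebra `F_t⁰ ∩ Σ_t` is absolutely continuous w.r.t. that of `μ`. -/
def LocAC (nu mu : Measure RPath) : Prop :=
  ∀ t : ℝ, 0 ≤ t → ∀ E ∈ trace t, mu E = 0 → nu E = 0

/-- `(M_t)` is a family of local Radon–Nikodym derivatives of `ν` w.r.t. `μ`. -/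
def IsLocRN (nu mu : Measure RPath) (M : ℝ → RPath → ℝ≥0∞) : Prop :=
  ∀ t : ℝ, 0 ≤ t → ∀ E ∈ trace t, nu E = ∫⁻ f in E, M t f ∂mu

end RPath

open RPath


lemma RPath.measurableSet_SigmaT (t : ℝ) (ht : 0 ≤ t) : MeasurableSet[F0 t] (SigmaT t) := by
  refine MeasurableSpace.measurableSet_generateFrom ⟨t, ht, le_rfl, univ, MeasurableSet.univ, ?_⟩
  ext f
  simp [SigmaT]

lemma RPath.F0_mono {s t : ℝ} (h : s ≤ t) : F0 s ≤ F0 t := by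
  refine MeasurableSpace.generateFrom_mono ?_
  rintro A ⟨r, hr, hrs, U, hU, rfl⟩
  exact ⟨r, hr, hrs.trans h, U, hU, rfl⟩

/-- The union of all trace σ-algebras. -/
def RPath.traces : Set (Set RPath) := {E | ∃ t : ℝ, 0 ≤ t ∧ E ∈ RPath.trace t}

lemma RPath.measurableSet_of_trace {t : ℝ} (ht : 0 ≤ t) {E : Set RPath} (hE : E ∈ trace t) :
    MeasurableSet E := by
  obtain ⟨A, hA, rfl⟩ := hE
  exact F0_le t _ (MeasurableSet.inter hA (measurableSet_SigmaT t ht))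

lemma RPath.isPiSystem_traces : IsPiSystem RPath.traces := by
  have key : ∀ s t : ℝ, 0 ≤ s → 0 ≤ t → s ≤ t → ∀ E ∈ trace s, ∀ F ∈ trace t, E ∩ F ∈ traces := by
    rintro s t hs ht hst E ⟨A, hA, rfl⟩ F ⟨B, hB, rfl⟩
    refine ⟨t, ht, (A ∩ SigmaT s) ∩ B, ?_, ?_⟩
    · exact MeasurableSet.inter
        (F0_mono hst _ (MeasurableSet.inter hA (measurableSet_SigmaT s hs))) hB
    · rw [inter_assoc, inter_assoc, inter_assoc]
  rintro E ⟨s, hs, hE⟩ F ⟨t, ht, hF⟩ -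
  rcases le_total s t with h | h
  · exact key s t hs ht h E hE F hF
  · rw [inter_comm]
    exact key t s ht hs h F hF E hE

lemma RPath.Finf_eq : Finf = MeasurableSpace.generateFrom traces := by
  apply le_antisymm
  · refine iSup_le fun t => MeasurableSpace.generateFrom_mono ?_
    rintro A ⟨r, hr, hrs, U, hU, rfl⟩
    refine ⟨r, hr, {f : RPath | ENNReal.ofReal r < f.T ∧ f.toFun r ∈ U},
      MeasurableSpace.measurableSet_generateFrom ⟨r, hr, le_rfl, U, hU, rfl⟩, ?_⟩
    ext f
    simp only [SigmaT, mem_inter_iff, mem_setOf_eq]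
    tauto
  · refine MeasurableSpace.generateFrom_le ?_
    rintro E ⟨t, ht, hE⟩
    exact measurableSet_of_trace ht hE

lemma RPath.univ_mem_traces : (univ : Set RPath) ∈ traces := by
  refine ⟨0, le_rfl, univ, MeasurableSet.univ, ?_⟩
  ext f
  simpa [SigmaT] using f.pos

lemma RPath.measurable_indicator {Upsilon : Type} [mU : MeasurableSpace Upsilon]
    (M : Upsilon → RPath → ℝ≥0∞) (t : ℝ) (ht : 0 ≤ t)
    (hM : @Measurable (Upsilon × ↥(SigmaT t)) ℝ≥0∞
        (mU.prod ((F0 t).comap (Subtype.val : SigmaT t → RPath))) inferInstance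
        (fun p => M p.1 p.2.val)) :
    Measurable (fun p : Upsilon × RPath => (SigmaT t).indicator (M p.1) p.2) := by
  have hM' : Measurable (fun p : Upsilon × ↥(SigmaT t) => M p.1 p.2.val) :=
    hM.mono (sup_le_sup le_rfl (MeasurableSpace.comap_mono
      (MeasurableSpace.comap_mono (F0_le t)))) le_rfl
  have hS : MeasurableSet (SigmaT t) := F0_le t _ (measurableSet_SigmaT t ht)
  have hS' : MeasurableSet (Prod.snd ⁻¹' (SigmaT t) : Set (Upsilon × RPath)) := measurable_snd hS
  refine measurable_of_restrict_of_restrict_compl hS' ?_ ?_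
  · have h1 : Measurable (fun p : (Prod.snd ⁻¹' (SigmaT t) : Set (Upsilon × RPath)) =>
        ((p.1.1, ⟨p.1.2, p.2⟩) : Upsilon × ↥(SigmaT t))) :=
      (measurable_fst.comp measurable_subtype_coe).prodMk
        ((measurable_snd.comp measurable_subtype_coe).subtype_mk)
    convert hM'.comp h1 using 1
    ext p
    exact indicator_of_mem (show p.1.2 ∈ SigmaT t from p.2) _
  · convert measurable_const (a := (0 : ℝ≥0∞)) using 1
    ext p
    exact indicator_of_notMem (show p.1.2 ∉ SigmaT t from p.2) _

/-- Proposition 2.1 (Prop-fubini): if each `ν(υ,·)` is a finite measure locally absolutely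
continuous w.r.t. `μ` with local Radon–Nikodym derivatives `M_t(υ,·)` that are jointly
measurable, then `ν` is a kernel from `Υ` to `(Σ, F⁰)`; moreover, for a σ-finite measure `ξ`
on `Υ` such that `μ`-a.s. `∫_Υ M_t(υ,·) dξ(υ) < ∞` for all `t ≥ 0`, the measure
`ξ·ν : F ↦ ∫_Υ ν(υ, F) dξ(υ)` is locally absolutely continuous w.r.t. `μ` with local
Radon–Nikodym derivatives `f ↦ ∫_Υ M_t(υ, f) dξ(υ)`. -/
theorem prop_fubini
    {Upsilon : Type} [mU : MeasurableSpace Upsilon]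
    (mu : Measure RPath)
    (hsf : SigmaFinite (mu.trim (RPath.F0_le 0)))
    (nu : Upsilon → Measure RPath)
    (hfin : ∀ u : Upsilon, IsFiniteMeasure (nu u))
    (hac : ∀ u : Upsilon, LocAC (nu u) mu)
    (M : ℝ → Upsilon → RPath → ℝ≥0∞)
    (hMfin : ∀ (t : ℝ) (u : Upsilon) (f : RPath), M t u f < ⊤)
    (hMmeas : ∀ t : ℝ, 0 ≤ t →
      @Measurable (Upsilon × ↥(SigmaT t)) ℝ≥0∞
        (mU.prod ((F0 t).comap (Subtype.val : SigmaT t → RPath))) inferInstance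
        (fun p => M t p.1 p.2.val))
    (hRN : ∀ u : Upsilon, IsLocRN (nu u) mu (fun t f => M t u f))
    (xi : Measure Upsilon) (hxisf : SigmaFinite xi)
    (hint : ∀ᵐ f ∂mu, ∀ t : ℝ, 0 ≤ t → ∫⁻ u, M t u f ∂xi < ⊤) :
    (∀ F : Set RPath, MeasurableSet F → Measurable fun u : Upsilon => nu u F) ∧
    (∀ t : ℝ, 0 ≤ t → ∀ E ∈ trace t,
      (mu E = 0 → ∫⁻ u, nu u E ∂xi = 0) ∧
      ∫⁻ u, nu u E ∂xi = ∫⁻ f in E, (∫⁻ u, M t u f ∂xi) ∂mu) := by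
  have hmu : SigmaFinite mu := SigmaFinite.of_trim (RPath.F0_le 0)
  have hN := fun (t : ℝ) (ht : 0 ≤ t) => measurable_indicator (M t) t ht (hMmeas t ht)
  have hcongr : ∀ t : ℝ, 0 ≤ t → ∀ E ∈ trace t, ∀ g : RPath → ℝ≥0∞,
      ∀ g' : RPath → ℝ≥0∞, (∀ f ∈ SigmaT t, g f = g' f) →
      ∫⁻ f in E, g f ∂mu = ∫⁻ f in E, g' f ∂mu := by
    intro t ht E hE g g' h
    refine setLIntegral_congr_fun (measurableSet_of_trace ht hE) ?_
    intro f hf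
    obtain ⟨A, hA, rfl⟩ := hE
    exact h f hf.2
  have hnu : ∀ t : ℝ, 0 ≤ t → ∀ E ∈ trace t, ∀ u,
      nu u E = ∫⁻ f in E, (SigmaT t).indicator (M t u) f ∂mu := by
    intro t ht E hE u
    rw [hRN u t ht E hE]
    exact hcongr t ht E hE _ _ fun f hf => (indicator_of_mem hf _).symm
  have hmeas : ∀ t : ℝ, 0 ≤ t → ∀ E ∈ trace t, Measurable fun u => nu u E := by
    intro t ht E hE
    simp_rw [hnu t ht E hE]
    exact (hN t ht).lintegral_prod_right'
  refine ⟨?_, ?_⟩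
  · intro F hF
    induction F, hF using MeasurableSpace.induction_on_inter RPath.Finf_eq
      RPath.isPiSystem_traces with
    | empty => simp
    | basic E hE =>
      obtain ⟨t, ht, hE⟩ := hE
      exact hmeas t ht E hE
    | compl E hE ih =>
      obtain ⟨t, ht, hu⟩ := univ_mem_traces
      have h : ∀ u, nu u Eᶜ = nu u univ - nu u E := fun u =>
        measure_compl hE (measure_ne_top _ _)
      simp_rw [h]
      exact (hmeas t ht _ hu).sub ih
    | iUnion g hd hg ih =>
      have h : ∀ u, nu u (⋃ i, g i) = ∑' i, nu u (g i) := fun u => measure_iUnion hd hg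
      simp_rw [h]
      exact Measurable.ennreal_tsum ih
  · intro t ht E hE
    refine ⟨fun h0 => ?_, ?_⟩
    · simp [fun u => hac u t ht E hE h0]
    · simp_rw [hnu t ht E hE]
      rw [lintegral_lintegral_swap (hN t ht).aemeasurable]
      refine hcongr t ht E hE _ _ fun f hf => ?_
      simp only [indicator_of_mem hf]
end
end

section
/- Let μ be a probability measure on (Σ, F⁰), and let ξ be a μ-kernel from (Σ, F⁰) to (0,∞) (with its Borel σ-algebra) such that E_μ[ξ(·,(0,∞))] < ∞. Then the killed measure K_ξ(μ) is locally absolutely continuous w.r.t. μ, and for each t ≥ 0 its local Radon–Nikodym derivative on the trace σ-algebra F_t⁰ ∩ Σ_t is (a version of) the conditional expectation E_μ[ξ(·,(t,∞)) | F_t⁰]. -/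
open MeasureTheory Set Filter ENNReal Topology

noncomputable section

namespace RPath

/-- The measure `μ ⊗ ξ` on `Σ × ℝ` associated with a (σ-finite) kernel `ξ` from `Σ` to `ℝ`:
`(μ ⊗ ξ)(E × F) = ∫_E ξ(f, F) dμ(f)`. -/
def kernelProd (mu : Measure RPath) (xi : RPath → Measure ℝ) : Measure (RPath × ℝ) :=
  mu.bind fun f => (xi f).map fun r => (f, r)

/-- The killed measure `K_ξ(μ)`: the pushforward of `μ ⊗ ξ` under `(f, r) ↦ K_r(f)`. -/
def kernelKilled (mu : Measure RPath) (xi : RPath → Measure ℝ) : Measure RPath :=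
  (kernelProd mu xi).map fun p => kill (ENNReal.ofReal p.2) p.1

end RPath

open RPath

open ProbabilityTheory in
lemma aux_kernel (mu : Measure RPath) [IsProbabilityMeasure mu]
    (xi : RPath → Measure ℝ)
    (hfin : ∀ᵐ f ∂mu, xi f univ < ⊤)
    (hmeas : ∀ F : Set ℝ, MeasurableSet F → NullMeasurable (fun f => xi f F) mu) :
    ∃ k : Kernel RPath ℝ,
      (∀ f, IsFiniteMeasure (k f)) ∧ ∀ᵐ f ∂mu, xi f = k f := by
  classical
  have hae : ∀ F : Set ℝ, MeasurableSet F → AEMeasurable (fun f => xi f F) mu :=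
    fun F hF => (hmeas F hF).aemeasurable
  let C : Set (Set ℝ) := insert univ (⋃ a : ℚ, {Iic (a : ℝ)})
  have hCc : C.Countable := (countable_iUnion fun a => countable_singleton _).insert _
  have hCm : ∀ F ∈ C, MeasurableSet F := by
    intro F hF
    rcases hF with rfl | hF
    · exact MeasurableSet.univ
    · obtain ⟨a, ha⟩ := mem_iUnion.1 hF
      rw [mem_singleton_iff.1 ha]; exact measurableSet_Iic
  have hall : ∀ᵐ f ∂mu, ∀ F, ∀ hF : F ∈ C, xi f F = (hae F (hCm F hF)).mk _ f :=
    (ae_ball_iff hCc).2 fun F hF => (hae F (hCm F hF)).ae_eq_mk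
  obtain ⟨G, hGsub, hGm, hG0⟩ : ∃ G : Set RPath, (∀ f ∈ G, xi f univ < ⊤ ∧
      ∀ F, ∀ hF : F ∈ C, xi f F = (hae F (hCm F hF)).mk _ f) ∧ MeasurableSet G ∧ mu Gᶜ = 0 := by
    obtain ⟨N, hN, hNm, hN0⟩ := exists_measurable_superset_of_null (ae_iff.1 (hfin.and hall))
    refine ⟨Nᶜ, fun f hf => ?_, hNm.compl, by simpa using hN0⟩
    by_contra h
    exact hf (hN h)
  let xi' : RPath → Measure ℝ := fun f => if f ∈ G then xi f else 0
  have hxf : ∀ f, IsFiniteMeasure (xi' f) := by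
    intro f
    by_cases h : f ∈ G
    · simp only [xi', h, if_true]; exact ⟨(hGsub f h).1⟩
    · simp only [xi', h, if_false]; infer_instance
  have hval : ∀ F ∈ C, Measurable (fun f => xi' f F) := by
    intro F hF
    have : (fun f => xi' f F) = fun f => if f ∈ G then (hae F (hCm F hF)).mk _ f else 0 := by
      ext f
      by_cases h : f ∈ G
      · simp only [xi', h, if_true]; exact (hGsub f h).2 F hF
      · simp [xi', h]
    rw [this]
    exact Measurable.ite hGm (hae F (hCm F hF)).measurable_mk measurable_const
  have hm : Measurable xi' := by
    refine Measurable.measure_of_isPiSystem (S := ⋃ a : ℚ, {Iic (a : ℝ)}) ?_ Real.isPiSystem_Iic_rat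
      (fun s hs => hval s (Or.inr hs)) (hval univ (Or.inl rfl))
    rw [← Real.borel_eq_generateFrom_Iic_rat]
    exact BorelSpace.measurable_eq
  refine ⟨⟨xi', hm⟩, hxf, ?_⟩
  · have : ∀ᵐ f ∂mu, f ∈ G := hG0
    filter_upwards [this] with f hf
    change xi f = xi' f
    simp [xi', hf]

namespace RPath

lemma meas_cyl (s : ℝ) (hs : 0 ≤ s) (U : Set ℝ) (hU : MeasurableSet U) (t : ℝ) (hst : s ≤ t) :
    MeasurableSet[F0 t] {f : RPath | ENNReal.ofReal s < f.T ∧ f.toFun s ∈ U} :=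
  MeasurableSpace.measurableSet_generateFrom ⟨s, hs, hst, U, hU, rfl⟩

lemma meas_SigmaT (t : ℝ) (ht : 0 ≤ t) : MeasurableSet[F0 t] (SigmaT t) := by
  have := meas_cyl t ht univ MeasurableSet.univ t le_rfl
  simpa [SigmaT] using this

lemma mem_kill (r s : ℝ) (hs : 0 ≤ s) (f : RPath) (U : Set ℝ) :
    (ENNReal.ofReal s < (kill (ENNReal.ofReal r) f).T ∧
      (kill (ENNReal.ofReal r) f).toFun s ∈ U) ↔
    ((0 < r → s < r) ∧ ENNReal.ofReal s < f.T ∧ f.toFun s ∈ U) := by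
  by_cases hr : 0 < r
  · have h : 0 < ENNReal.ofReal r := by simpa using hr
    have key : ENNReal.ofReal s < ENNReal.ofReal r ↔ s < r := ENNReal.ofReal_lt_ofReal_iff hr
    simp only [kill, h, dif_pos, lt_min_iff, key, hr, hs, true_and, forall_const]
    constructor
    · rintro ⟨⟨h1, h2⟩, h3⟩
      simp only [h1, h2, and_self, dif_pos] at h3
      exact ⟨h1, h2, h3⟩
    · rintro ⟨h1, h2, h3⟩
      refine ⟨⟨h1, h2⟩, ?_⟩
      simpa only [h1, h2, and_self, dif_pos] using h3
  · have h : ¬ 0 < ENNReal.ofReal r := by simpa using hr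
    simp [kill, h, hr]

lemma measurable_kill : Measurable fun p : RPath × ℝ => kill (ENNReal.ofReal p.2) p.1 := by
  have hF : (inferInstance : MeasurableSpace RPath)
      = MeasurableSpace.generateFrom (⋃ t, cyl t) := by
    change Finf = _
    unfold Finf F0
    exact MeasurableSpace.iSup_generateFrom cyl
  have : ∀ A ∈ ⋃ t, cyl t,
      MeasurableSet ((fun p : RPath × ℝ => kill (ENNReal.ofReal p.2) p.1) ⁻¹' A) := by
    intro A hA
    obtain ⟨t, s, hs, hst, U, hU, rfl⟩ := mem_iUnion.1 hA
    have e : ((fun p : RPath × ℝ => kill (ENNReal.ofReal p.2) p.1) ⁻¹'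
        {f : RPath | ENNReal.ofReal s < f.T ∧ f.toFun s ∈ U}) =
        (Prod.snd ⁻¹' (Iic 0 ∪ Ioi s)) ∩
        (Prod.fst ⁻¹' {f : RPath | ENNReal.ofReal s < f.T ∧ f.toFun s ∈ U}) := by
      ext p
      have := mem_kill p.2 s hs p.1 U
      simp only [mem_preimage, mem_setOf_eq, mem_inter_iff, mem_union, mem_Iic, mem_Ioi]
      rw [this]
      rw [imp_iff_not_or, not_lt]
    rw [e]
    exact (measurable_snd (measurableSet_Iic.union measurableSet_Ioi)).inter
      (measurable_fst (F0_le t _ (meas_cyl s hs U hU t hst)))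
  have h2 := measurable_generateFrom this
  rw [← hF] at h2
  exact h2

lemma kill_mem_F0 (t r : ℝ) (htr : t < r) (f : RPath) (A : Set RPath)
    (hA : MeasurableSet[F0 t] A) : kill (ENNReal.ofReal r) f ∈ A ↔ f ∈ A := by
  induction A, hA using MeasurableSpace.generateFrom_induction with
  | hC A hA _ =>
    obtain ⟨s, hs, hst, U, hU, rfl⟩ := hA
    have := mem_kill r s hs f U
    simp only [mem_setOf_eq]
    rw [this]
    exact ⟨fun h => h.2, fun h => ⟨fun _ => hst.trans_lt htr, h⟩⟩
  | empty => simp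
  | compl A _ ih => simp [ih]
  | iUnion A _ ih => simp [ih]

lemma kill_mem_trace (t r : ℝ) (ht : 0 ≤ t) (hr : 0 < r) (f : RPath) (A : Set RPath)
    (hA : MeasurableSet[F0 t] A) :
    kill (ENNReal.ofReal r) f ∈ A ∩ SigmaT t ↔ t < r ∧ f ∈ A ∩ SigmaT t := by
  have h := mem_kill r t ht f univ
  simp only [mem_univ, and_true, hr, forall_const] at h
  constructor
  · rintro ⟨h1, h2⟩
    have h3 := h.1 h2
    exact ⟨h3.1, (kill_mem_F0 t r h3.1 f A hA).1 h1, h3.2⟩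
  · rintro ⟨h1, h2, h3⟩
    exact ⟨(kill_mem_F0 t r h1 f A hA).2 h2, h.2 ⟨h1, h3⟩⟩

open ProbabilityTheory in
lemma killed_apply (mu : Measure RPath) [IsProbabilityMeasure mu]
    (xi : RPath → Measure ℝ)
    (hsupp : ∀ f : RPath, xi f (Set.Iic (0:ℝ)) = 0)
    (k : Kernel RPath ℝ) (hkf : ∀ f, IsFiniteMeasure (k f)) (hk : ∀ᵐ f ∂mu, xi f = k f)
    (t : ℝ) (ht : 0 ≤ t) (A : Set RPath) (hA : MeasurableSet[F0 t] A) :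
    kernelKilled mu xi (A ∩ SigmaT t) = ∫⁻ f in A ∩ SigmaT t, xi f (Ioi t) ∂mu := by
  have hE : MeasurableSet (A ∩ SigmaT t) := F0_le t _ (hA.inter (meas_SigmaT t ht))
  have hmk : Measurable (fun f => (k f).map fun r => (f, r)) := by
    refine Measurable.measure_of_isPiSystem generateFrom_prod.symm isPiSystem_prod ?_ ?_
    · rintro _ ⟨S, hS', R, hR', rfl⟩
      have hS : MeasurableSet S := hS'
      have hR : MeasurableSet R := hR'
      have : (fun f => ((k f).map fun r => (f, r)) (S ×ˢ R)) = S.indicator fun f => k f R := by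
        ext f
        rw [Measure.map_apply measurable_prodMk_left (MeasurableSet.prod hS hR)]
        by_cases h : f ∈ S <;> simp [h, indicator]
      rw [this]
      exact (k.measurable_coe hR).indicator hS
    · have : (fun f => ((k f).map fun r => (f, r)) univ) = fun f => k f univ := by
        ext f
        rw [Measure.map_apply measurable_prodMk_left MeasurableSet.univ]
        simp
      rw [this]
      exact k.measurable_coe MeasurableSet.univ
  have hbm : AEMeasurable (fun f => (xi f).map fun r => (f, r)) mu :=
    ⟨_, hmk, by filter_upwards [hk] with f hf; rw [hf]⟩
  rw [kernelKilled, Measure.map_apply measurable_kill hE, kernelProd,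
    Measure.bind_apply (measurable_kill hE) hbm, ← lintegral_indicator hE]
  refine lintegral_congr fun f => ?_
  rw [Measure.map_apply measurable_prodMk_left (measurable_kill hE)]
  have hpos : ∀ᵐ r ∂(xi f), 0 < r := by
    rw [ae_iff]; simpa [Iic] using hsupp f
  by_cases hf : f ∈ A ∩ SigmaT t
  · rw [indicator_of_mem hf]
    refine measure_congr ?_
    filter_upwards [hpos] with r hr
    apply propext
    change kill (ENNReal.ofReal r) f ∈ A ∩ SigmaT t ↔ t < r
    rw [kill_mem_trace t r ht hr f A hA]
    simp only [hf, and_true]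
  · rw [indicator_of_notMem hf]
    rw [← measure_empty (μ := xi f)]
    refine measure_congr ?_
    filter_upwards [hpos] with r hr
    apply propext
    change kill (ENNReal.ofReal r) f ∈ A ∩ SigmaT t ↔ False
    rw [kill_mem_trace t r ht hr f A hA]
    simp only [hf, and_false]

end RPath

/-- Proposition 2.2 (Prop-trunc): if `μ` is a probability measure on `(Σ, F⁰)` and `ξ` is a
`μ`-kernel from `Σ` to `(0,∞)` with `E_μ[|ξ|] < ∞`, then the killed measure `K_ξ(μ)` is
locally absolutely continuous w.r.t. `μ`, and for each `t ≥ 0` its local Radon–Nikodym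
derivative on the trace σ-algebra `F_t⁰ ∩ Σ_t` is the conditional expectation
`E_μ[ξ(·,(t,∞)) | F_t⁰]`. -/
theorem prop_trunc
    (mu : Measure RPath) [IsProbabilityMeasure mu]
    (xi : RPath → Measure ℝ)
    (hsupp : ∀ f : RPath, xi f (Set.Iic (0:ℝ)) = 0)
    (hmeas : ∀ F : Set ℝ, MeasurableSet F → NullMeasurable (fun f => xi f F) mu)
    (hint : ∫⁻ f, xi f (Set.Ioi (0:ℝ)) ∂mu < ⊤) :
    LocAC (kernelKilled mu xi) mu ∧
    ∀ t : ℝ, 0 ≤ t → ∀ E ∈ trace t,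
      kernelKilled mu xi E
        = ∫⁻ f in E,
            ENNReal.ofReal ((mu[fun g : RPath => (xi g (Set.Ioi t)).toReal | F0 t]) f) ∂mu := by
  have hfin0 : ∀ᵐ f ∂mu, xi f univ < ⊤ := by
    have h1 := ae_lt_top' (hmeas (Ioi 0) measurableSet_Ioi).aemeasurable hint.ne
    filter_upwards [h1] with f hf
    have : (univ : Set ℝ) = Iic 0 ∪ Ioi 0 := by simp
    rw [this]
    refine (measure_union_le _ _).trans_lt ?_
    rw [hsupp f, zero_add]
    exact hf
  obtain ⟨k, hkf, hk⟩ := aux_kernel mu xi hfin0 hmeas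
  have main : ∀ t : ℝ, 0 ≤ t → ∀ E ∈ trace t,
      kernelKilled mu xi E
        = ∫⁻ f in E,
            ENNReal.ofReal ((mu[fun g : RPath => (xi g (Set.Ioi t)).toReal | F0 t]) f) ∂mu := by
    rintro t ht _ ⟨A, hA, rfl⟩
    rw [killed_apply mu xi hsupp k hkf hk t ht A hA]
    have hE0 : MeasurableSet[F0 t] (A ∩ SigmaT t) := hA.inter (meas_SigmaT t ht)
    have hfin : ∫⁻ f, xi f (Ioi t) ∂mu ≠ ⊤ :=
      ((lintegral_mono fun f => measure_mono (Ioi_subset_Ioi ht)).trans_lt hint).ne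
    have hI : Integrable (fun g : RPath => (xi g (Set.Ioi t)).toReal) mu :=
      integrable_toReal_of_lintegral_ne_top (hmeas _ measurableSet_Ioi).aemeasurable hfin
    have hnn : 0 ≤ᵐ[mu] mu[fun g : RPath => (xi g (Set.Ioi t)).toReal | F0 t] :=
      condExp_nonneg (ae_of_all _ fun f => ENNReal.toReal_nonneg)
    have hc := setIntegral_condExp (F0_le t) hI hE0
    rw [← ofReal_integral_eq_lintegral_ofReal integrable_condExp.integrableOn
      (ae_restrict_of_ae hnn), hc, ofReal_integral_eq_lintegral_ofReal hI.integrableOn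
      (ae_of_all _ fun f => ENNReal.toReal_nonneg)]
    refine lintegral_congr_ae (ae_restrict_of_ae ?_)
    filter_upwards [hfin0] with f hf
    rw [ENNReal.ofReal_toReal]
    exact ((measure_mono (subset_univ _)).trans_lt hf).ne
  refine ⟨fun t ht E hE h0 => ?_, main⟩
  rw [main t ht E hE, Measure.restrict_eq_zero.2 h0, lintegral_zero_measure]
end
end

section
/- Fix t ≥ 0 and let E be a set in the trace σ-algebra F_t⁰ ∩ Σ_t (in particular E ⊆ Σ_t). Then for every f ∈ Σ and every r ∈ (0,∞], one has K_r(f) ∈ E if and only if f ∈ E and r > t. -/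
open MeasureTheory Set Filter ENNReal Topology

noncomputable section

open RPath

/-- For `t ≥ 0` and `E` in the trace σ-algebra `F_t⁰ ∩ Σ_t`, and any `f ∈ Σ`,
`0 < r ≤ ∞`: `K_r(f) ∈ E` if and only if `f ∈ E` and `r > t`. -/
theorem kill_mem_trace_iff :
    ∀ t : ℝ, 0 ≤ t → ∀ E ∈ trace t, ∀ f : RPath, ∀ r : ℝ≥0∞, 0 < r →
      (kill r f ∈ E ↔ f ∈ E ∧ ENNReal.ofReal t < r) := by
  rintro t ht E ⟨A, hA, rfl⟩ f r hr
  have hT : (kill r f).T = min r f.T := by simp [kill, hr]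
  have key : ENNReal.ofReal t < r → ENNReal.ofReal t < f.T → (kill r f ∈ A ↔ f ∈ A) := by
    intro h1 h2
    induction A, hA using MeasurableSpace.generateFrom_induction with
    | hC B hB _ =>
      obtain ⟨s, hs0, hst, U, hU, rfl⟩ := hB
      have hs : ENNReal.ofReal s ≤ ENNReal.ofReal t := ENNReal.ofReal_le_ofReal hst
      have h3 := lt_of_le_of_lt hs h1
      have h4 := lt_of_le_of_lt hs h2
      have hv : (kill r f).toFun s = f.toFun s := by simp [kill, hr, hs0, h3, h4]
      simp only [Set.mem_setOf_eq, hT, hv, lt_min_iff, h3, h4, true_and]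
    | empty => simp
    | compl B _ ih => exact not_congr ih
    | iUnion B _ ih => simp only [Set.mem_iUnion, ih]
  simp only [Set.mem_inter_iff, SigmaT, Set.mem_setOf_eq, hT, lt_min_iff]
  constructor
  · rintro ⟨a, b, c⟩
    exact ⟨⟨(key b c).1 a, c⟩, b⟩
  · rintro ⟨⟨a, c⟩, b⟩
    exact ⟨(key b c).2 a, b, c⟩
end
end

section
/- Let T ∈ (0,∞], y₀ > 0, and let X, Y : [0,T) → ℝ be continuous with Y(t) > 0 for all t, Y(0) = y₀, and Y differentiable with Y′(t) = −2 Y(t)/(X(t)² + Y(t)²). Define u(t) = ∫₀ᵗ (X(s)² + Y(s)²)⁻¹ ds, and assume u(t) → ∞ as t → T⁻, so that u has a continuous strictly increasing inverse v : [0,∞) → [0,T). Set V_s = arcsinh(X(v(s))/Y(v(s))). Then: (i) Y(v(s)) = y₀ e^{−2s} for all s ≥ 0; (ii) T = y₀² ∫₀^∞ e^{−4s} cosh²(V_s) ds. -/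
open Set Filter Topology ENNReal MeasureTheory

noncomputable section

/-- The time domain `[0, T)` for a lifetime `T ∈ (0,∞]`. -/
def domT (T : ℝ≥0∞) : Set ℝ := {t : ℝ | 0 ≤ t ∧ ENNReal.ofReal t < T}

/-- The filter of times `t → T⁻` (i.e. `t → ∞` when `T = ∞`). -/
def leftLimFilter (T : ℝ≥0∞) : Filter ℝ := if T = ⊤ then atTop else 𝓝[<] T.toReal

theorem domT_cases (T : ℝ≥0∞) :
    (T = ⊤ ∧ domT T = Ici 0) ∨ (T = ENNReal.ofReal T.toReal ∧ domT T = Ico 0 T.toReal) := by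
  by_cases h : T = ⊤
  · left
    refine ⟨h, ?_⟩
    ext t
    simp [domT, h]
  · right
    refine ⟨(ENNReal.ofReal_toReal h).symm, ?_⟩
    ext t
    simp only [domT, mem_ofPred_eq, mem_Ico]
    refine and_congr_right fun h0 => ?_
    rw [ENNReal.ofReal_lt_iff_lt_toReal h0 h]

theorem domT_ordConnected (T : ℝ≥0∞) : (domT T).OrdConnected := by
  rcases domT_cases T with ⟨_, h⟩ | ⟨_, h⟩ <;> rw [h]
  · exact ordConnected_Ici
  · exact ordConnected_Ico

theorem volume_domT (T : ℝ≥0∞) : volume (domT T) = T := by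
  rcases domT_cases T with ⟨h', h⟩ | ⟨h', h⟩ <;> rw [h]
  · simp [h']
  · rw [Real.volume_Ico, sub_zero, ← h']

theorem domT_exists_gt (T : ℝ≥0∞) (t : ℝ) (ht : t ∈ domT T) : ∃ b ∈ domT T, t < b := by
  rcases domT_cases T with ⟨h', h⟩ | ⟨h', h⟩ <;> rw [h] at ht ⊢
  · exact ⟨t + 1, by simp only [mem_Ici] at *; linarith, by linarith⟩
  · obtain ⟨b, h1, h2⟩ := exists_between ht.2
    exact ⟨b, ⟨ht.1.trans h1.le, h2⟩, h1⟩

theorem domT_hasDeriv (T : ℝ≥0∞) (hT : 0 < T) (g : ℝ → ℝ) (hg : ContinuousOn g (domT T)) (t : ℝ)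
    (ht : t ∈ domT T) :
    HasDerivWithinAt (fun t => ∫ s in (0:ℝ)..t, g s) (g t) (domT T) t := by
  obtain ⟨b, hb, htb⟩ := domT_exists_gt T t ht
  have h0 : (0:ℝ) ∈ domT T := ⟨le_rfl, by simpa using hT⟩
  have hsub : Icc 0 b ⊆ domT T := (domT_ordConnected T).out h0 hb
  have hgb := hg.mono hsub
  have hmem : t ∈ Icc 0 b := ⟨ht.1, htb.le⟩
  have : Fact (t ∈ Icc 0 b) := ⟨hmem⟩
  have key : HasDerivWithinAt (fun t => ∫ s in (0:ℝ)..t, g s) (g t) (Icc 0 b) t := by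
    refine intervalIntegral.integral_hasDerivWithinAt_right ?_ ?_ (hgb t hmem)
    · apply ContinuousOn.intervalIntegrable
      rw [uIcc_of_le ht.1]
      exact hgb.mono (Icc_subset_Icc_right htb.le)
    · exact hgb.stronglyMeasurableAtFilter_nhdsWithin measurableSet_Icc t
  refine key.mono_of_mem_nhdsWithin ?_
  filter_upwards [self_mem_nhdsWithin, mem_nhdsWithin_of_mem_nhds (Iio_mem_nhds htb)] with x hx hx'
  exact ⟨hx.1, le_of_lt hx'⟩

/-- Formula (16) of the paper (deterministic time-change identity): if `Y` solves
`Y′ = −2Y/(X²+Y²)` with `Y(0) = y₀ > 0` on `[0,T)`, `u(t) = ∫₀ᵗ (X²+Y²)⁻¹ ds → ∞` as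
`t → T⁻`, `v` is the inverse of `u`, and `V_s = arcsinh(X(v(s))/Y(v(s)))`, then
(i) `Y(v(s)) = y₀ e^{−2s}`, and (ii) `T = y₀² ∫₀^∞ e^{−4s} cosh²(V_s) ds`. -/
theorem loewner_time_change
    (T : ℝ≥0∞) (hT : 0 < T) (y₀ : ℝ) (hy₀ : 0 < y₀)
    (X Y : ℝ → ℝ)
    (hXc : ContinuousOn X (domT T)) (hYc : ContinuousOn Y (domT T))
    (hYpos : ∀ t ∈ domT T, 0 < Y t) (hY0 : Y 0 = y₀)
    (hYder : ∀ t ∈ domT T,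
      HasDerivWithinAt Y (-2 * Y t / (X t ^ 2 + Y t ^ 2)) (domT T) t)
    (U : ℝ → ℝ) (hU : U = fun t => ∫ s in (0:ℝ)..t, (X s ^ 2 + Y s ^ 2)⁻¹)
    (hUtop : Tendsto U (leftLimFilter T) atTop)
    (v : ℝ → ℝ)
    (hvmem : ∀ s : ℝ, 0 ≤ s → v s ∈ domT T)
    (hUv : ∀ s : ℝ, 0 ≤ s → U (v s) = s)
    (hvU : ∀ t ∈ domT T, v (U t) = t)
    (hvmono : StrictMonoOn v (Ici (0:ℝ)))
    (hvcont : ContinuousOn v (Ici (0:ℝ)))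
    (V : ℝ → ℝ) (hV : V = fun s => Real.arsinh (X (v s) / Y (v s))) :
    (∀ s : ℝ, 0 ≤ s → Y (v s) = y₀ * Real.exp (-2 * s)) ∧
    T = ENNReal.ofReal (y₀ ^ 2) *
        ∫⁻ s in Set.Ioi (0:ℝ), ENNReal.ofReal (Real.exp (-4 * s) * Real.cosh (V s) ^ 2) := by
  have h0 : (0:ℝ) ∈ domT T := ⟨le_rfl, by simpa using hT⟩
  have hpos : ∀ t ∈ domT T, 0 < X t ^ 2 + Y t ^ 2 := fun t ht => by
    have := hYpos t ht
    positivity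
  have hUd : ∀ t ∈ domT T, HasDerivWithinAt U ((X t ^ 2 + Y t ^ 2)⁻¹) (domT T) t := by
    intro t ht
    rw [hU]
    exact domT_hasDeriv T hT (fun s => (X s ^ 2 + Y s ^ 2)⁻¹)
      (((hXc.pow 2).add (hYc.pow 2)).inv₀ fun t ht => (hpos t ht).ne') t ht
  have hU0 : U 0 = 0 := by rw [hU]; simp
  have hUnn : ∀ t ∈ domT T, 0 ≤ U t := by
    intro t ht
    rw [hU]
    exact intervalIntegral.integral_nonneg ht.1 fun s _ => by positivity
  have hYU : ∀ t ∈ domT T, Y t = y₀ * Real.exp (-2 * U t) := by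
    intro t ht
    have hd : ∀ t ∈ domT T, HasDerivWithinAt (fun t => Y t * Real.exp (2 * U t)) 0 (domT T) t := by
      intro t ht
      have := (hYder t ht).mul (((hUd t ht).const_mul 2).exp)
      refine this.congr_deriv ?_
      have := (hpos t ht).ne'
      field_simp
      ring
    have h1 := (domT_ordConnected T).convex.norm_image_sub_le_of_norm_hasDerivWithin_le
      (C := 0) hd (by simp) h0 ht
    have h2 : Y t * Real.exp (2 * U t) = y₀ := by
      have h3 := norm_le_zero_iff.1 (h1.trans (by simp))
      simp only [hU0, hY0, mul_zero, Real.exp_zero, mul_one] at h3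
      linarith
    rw [← h2, mul_assoc, ← Real.exp_add]
    simp
  refine ⟨fun s hs => ?_, ?_⟩
  · rw [hYU _ (hvmem s hs), hUv s hs]
  have himg : U '' domT T = Ici 0 := by
    ext s
    constructor
    · rintro ⟨t, ht, rfl⟩
      exact hUnn t ht
    · intro hs
      exact ⟨v s, hvmem s hs, hUv s hs⟩
  have hinj : InjOn U (domT T) := fun a ha b hb hab => by
    rw [← hvU a ha, ← hvU b hb, hab]
  have hmeas : MeasurableSet (domT T) := (domT_ordConnected T).measurableSet
  rw [← lintegral_const_mul' _ _ ENNReal.ofReal_ne_top, setLIntegral_congr Ioi_ae_eq_Ici, ← himg,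
    lintegral_image_eq_lintegral_abs_deriv_mul hmeas hUd hinj]
  have : ∫⁻ x in domT T, (1 : ℝ≥0∞) = T := by
    rw [setLIntegral_one, volume_domT]
  refine this.symm.trans (setLIntegral_congr_fun hmeas fun t ht => ?_)
  have hp := hpos t ht
  have hy := hYpos t ht
  have hc : Real.cosh (V (U t)) ^ 2 = 1 + (X t / Y t) ^ 2 := by
    rw [Real.cosh_sq, hV]
    simp only [hvU t ht, Real.sinh_arsinh]
    ring
  have he : y₀ ^ 2 * Real.exp (-4 * U t) = Y t ^ 2 := by
    rw [hYU t ht, mul_pow, ← Real.exp_nat_mul]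
    congr 2
    push_cast
    ring
  rw [← ENNReal.ofReal_mul (by positivity), ← ENNReal.ofReal_mul (by positivity), hc,
    ← mul_assoc (y₀ ^ 2),
    he, abs_of_pos (by positivity), ← ENNReal.ofReal_one]
  congr 1
  field_simp
  ring
end
end

section
/- Let κ > 0, b > 0, x₀ > 0, y₀ > 0, and let V : [0,∞) → ℝ satisfy sinh(V_0) = x₀/y₀ and V_s ≥ V_0 − 1 − b s − (κ/2 + 4)s for all s ≥ 0. Then y₀² ∫₀^∞ e^{−4s} cosh²(V_s) ds ≥ e^{−2} x₀²/(κ + 12 + 2b). -/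
open Set Filter Topology ENNReal MeasureTheory

noncomputable section

/-- The deterministic estimate from the proof of Lemma 5.1 (finiteness of `C_{κ,1}`): if
`sinh(V₀) = x₀/y₀` with `x₀, y₀ > 0` and `V_s ≥ V₀ − 1 − bs − (κ/2 + 4)s` for all
`s ≥ 0`, then `y₀² ∫₀^∞ e^{−4s} cosh²(V_s) ds ≥ e^{−2} x₀²/(κ + 12 + 2b)`. -/
theorem swallowing_time_lower_bound
    (kappa b x₀ y₀ : ℝ) (hkappa : 0 < kappa) (hb : 0 < b) (hx₀ : 0 < x₀) (hy₀ : 0 < y₀)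
    (V : ℝ → ℝ)
    (hV0 : Real.sinh (V 0) = x₀ / y₀)
    (hVlow : ∀ s : ℝ, 0 ≤ s → V 0 - 1 - b * s - (kappa / 2 + 4) * s ≤ V s) :
    ENNReal.ofReal (Real.exp (-2) * x₀ ^ 2 / (kappa + 12 + 2 * b))
      ≤ ENNReal.ofReal (y₀ ^ 2) *
          ∫⁻ s in Set.Ioi (0:ℝ), ENNReal.ofReal (Real.exp (-4 * s) * Real.cosh (V s) ^ 2) := by
  have hc : 0 < kappa + 12 + 2 * b := by positivity
  have hneg : -(kappa + 12 + 2 * b) < 0 := by linarith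
  have hS : 0 < Real.sinh (V 0) := by rw [hV0]; positivity
  have hpt : ∀ s ∈ Set.Ioi (0:ℝ),
      ENNReal.ofReal (Real.exp (-2) * (x₀ / y₀) ^ 2 * Real.exp (-(kappa + 12 + 2 * b) * s))
        ≤ ENNReal.ofReal (Real.exp (-4 * s) * Real.cosh (V s) ^ 2) := by
    intro s hs
    apply ENNReal.ofReal_le_ofReal
    have h1 := hVlow s (le_of_lt hs)
    have h2 : Real.sinh (V 0) * Real.exp (-1 - b * s - (kappa / 2 + 4) * s)
        ≤ Real.cosh (V s) := by
      have e1 : Real.exp (V 0) * Real.exp (-1 - b * s - (kappa / 2 + 4) * s)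
          ≤ Real.exp (V s) := by
        rw [← Real.exp_add]
        apply Real.exp_le_exp.mpr
        linarith
      have e2 : 0 < Real.exp (-V 0) * Real.exp (-1 - b * s - (kappa / 2 + 4) * s) := by
        positivity
      have e3 := Real.exp_pos (-V s)
      rw [Real.sinh_eq, Real.cosh_eq]
      linarith
    have h3 := pow_le_pow_left₀ (by positivity) h2 2
    calc Real.exp (-2) * (x₀ / y₀) ^ 2 * Real.exp (-(kappa + 12 + 2 * b) * s)
        = Real.exp (-4 * s) *
          (Real.sinh (V 0) * Real.exp (-1 - b * s - (kappa / 2 + 4) * s)) ^ 2 := by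
          have : Real.exp (-2) * Real.exp (-(kappa + 12 + 2 * b) * s)
              = Real.exp (-4 * s) * Real.exp (-1 - b * s - (kappa / 2 + 4) * s) ^ 2 := by
            rw [← Real.exp_nat_mul, ← Real.exp_add, ← Real.exp_add]
            congr 1
            push_cast
            ring
          rw [hV0, mul_pow]
          linear_combination (x₀ / y₀) ^ 2 * this
      _ ≤ _ := by gcongr
  have hint := (integrableOn_exp_mul_Ioi hneg 0).const_mul (Real.exp (-2) * (x₀ / y₀) ^ 2)
  have hI : ENNReal.ofReal (Real.exp (-2) * (x₀ / y₀) ^ 2 * (1 / (kappa + 12 + 2 * b)))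
      = ∫⁻ s in Set.Ioi (0:ℝ), ENNReal.ofReal
        (Real.exp (-2) * (x₀ / y₀) ^ 2 * Real.exp (-(kappa + 12 + 2 * b) * s)) := by
    rw [← ofReal_integral_eq_lintegral_ofReal hint
      (Filter.Eventually.of_forall fun s => by positivity),
      integral_const_mul, integral_exp_mul_Ioi hneg 0]
    congr 2
    rw [mul_zero, Real.exp_zero, neg_div_neg_eq]
  calc ENNReal.ofReal (Real.exp (-2) * x₀ ^ 2 / (kappa + 12 + 2 * b))
      = ENNReal.ofReal (y₀ ^ 2) *
        ENNReal.ofReal (Real.exp (-2) * (x₀ / y₀) ^ 2 * (1 / (kappa + 12 + 2 * b))) := by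
        rw [← ENNReal.ofReal_mul (by positivity)]
        congr 1
        field_simp
    _ ≤ _ := by
        rw [hI]
        exact mul_le_mul_right (setLIntegral_mono' measurableSet_Ioi hpt) _
end
end
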